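/- Let T be the truncated Fourier–Plancherel operator on L²(ℝ⁺). Then the spectrum of T (as an element of the Banach algebra of bounded linear operators on L²(ℝ⁺)) is exactly the segment [−e^{iπ/4}/√2, e^{iπ/4}/√2] in the complex plane. -/

import Mathlib

open MeasureTheory Set

/-- Lebesgue measure restricted to `(0,∞)`. -/
noncomputable def m0 : Measure ℝ := volume.restrict (Ioi (0:ℝ))

open Filter Topology

instance m0_sfinite : SFinite m0 := by unfold m0; infer_instance

lemma ae_m0_pos : ∀ᵐ t ∂m0, 0 < t := by
  unfold m0; exact ae_restrict_mem measurableSet_Ioi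

lemma damp_pointwise (x : ℝ → ℂ) (hx : Integrable x m0) (δ : ℝ) (hδ : 0 < δ) (t : ℝ) :
    ∫ s, (Complex.exp (-δ * s) * ∫ ξ, x ξ * Complex.exp (Complex.I * s * ξ) ∂m0)
      * Complex.exp (Complex.I * t * s) ∂m0
      = ∫ ξ, x ξ * (1 / (δ - Complex.I * (t + ξ))) ∂m0 := by
  have hE : Integrable (fun s : ℝ => Complex.exp (-δ * s)) m0 := by
    have := integrableOn_exp_mul_complex_Ioi (a := -δ) (by simpa using hδ) 0
    exact this
  have hI : Integrable (Function.uncurry fun (s ξ : ℝ) =>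
      x ξ * Complex.exp ((-δ + Complex.I * (t + ξ)) * s)) (m0.prod m0) := by
    have h1 := hE.mul_prod hx
    have h2 : Integrable (fun z : ℝ × ℝ => (Complex.exp (-δ * z.1) * x z.2) *
       Complex.exp (Complex.I * (t + z.2) * z.1)) (m0.prod m0) := by
      refine h1.mul_bdd (c := 1) ?_ ?_
      · exact (by fun_prop : Continuous fun z : ℝ × ℝ => Complex.exp (Complex.I * (t + z.2) * z.1)).aestronglyMeasurable
      · refine Eventually.of_forall fun z => ?_
        simp [Complex.norm_exp]
    refine h2.congr (Eventually.of_forall fun z => ?_)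
    simp only [Function.uncurry]
    rw [mul_right_comm, ← Complex.exp_add, mul_comm]
    congr 2; ring
  calc _ = ∫ s, ∫ ξ, x ξ * Complex.exp ((-δ + Complex.I * (t + ξ)) * s) ∂m0 ∂m0 := by
        congr 1; ext s
        rw [mul_right_comm, ← integral_const_mul]
        congr 1; ext ξ
        rw [mul_left_comm, ← Complex.exp_add, ← Complex.exp_add]
        congr 2; ring
    _ = ∫ ξ, ∫ s, x ξ * Complex.exp ((-δ + Complex.I * (t + ξ)) * s) ∂m0 ∂m0 :=
        integral_integral_swap hI
    _ = _ := by
        congr 1; ext ξ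
        rw [integral_const_mul]
        congr 1
        unfold m0
        rw [integral_exp_mul_complex_Ioi (by simpa using hδ)]
        simp only [Complex.ofReal_zero, mul_zero, Complex.exp_zero]
        rw [← neg_div_neg_eq]
        congr 1 <;> ring

lemma damp_tendsto (f : Lp ℂ 2 m0) (g : ℕ → Lp ℂ 2 m0)
    (hg : ∀ n, g n =ᵐ[m0] fun s => Complex.exp (-((1 / ((n:ℝ) + 1) : ℝ) : ℂ) * s) * f s) :
    Tendsto g atTop (𝓝 f) := by
  rw [Lp.tendsto_Lp_iff_tendsto_eLpNorm']
  have hsm := (Lp.stronglyMeasurable f).measurable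
  have key : ∀ n, eLpNorm (g n - f : ℝ → ℂ) 2 m0 =
      (∫⁻ s, ‖(Complex.exp (-((1 / ((n:ℝ) + 1) : ℝ) : ℂ) * s) - 1) * f s‖ₑ ^ (2:ℝ) ∂m0) ^ (1/2:ℝ) := by
    intro n
    rw [eLpNorm_eq_lintegral_rpow_enorm_toReal (by norm_num) (by norm_num)]
    simp only [ENNReal.toReal_ofNat]
    congr 1
    apply lintegral_congr_ae
    filter_upwards [hg n] with s hs
    simp only [Pi.sub_apply, hs]
    congr 2; ring
  have hlim : Tendsto (fun n : ℕ => ∫⁻ s, ‖(Complex.exp (-((1 / ((n:ℝ) + 1) : ℝ) : ℂ) * s) - 1) * f s‖ₑ ^ (2:ℝ) ∂m0) atTop (𝓝 (∫⁻ s, (0 : ENNReal) ∂m0)) := by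
    refine tendsto_lintegral_of_dominated_convergence (fun s => (2 * ‖f s‖ₑ) ^ (2:ℝ)) ?_ ?_ ?_ ?_
    · intro n
      fun_prop
    · intro n
      filter_upwards [ae_m0_pos] with s hs
      simp only [enorm_mul]
      gcongr
      have h1 : ‖Complex.exp (-((1 / ((n:ℝ) + 1) : ℝ) : ℂ) * s) - 1‖ ≤ 2 := by
        refine (norm_sub_le _ _).trans ?_
        have : ‖Complex.exp (-((1 / ((n:ℝ) + 1) : ℝ) : ℂ) * s)‖ ≤ 1 := by
          rw [← Complex.ofReal_neg, ← Complex.ofReal_mul, ← Complex.ofReal_exp, Complex.norm_real,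
            Real.norm_of_nonneg (Real.exp_pos _).le, Real.exp_le_one_iff]
          have : 0 < (1 / ((n:ℝ) + 1)) := by positivity
          nlinarith
        simp only [norm_one]; linarith
      rw [← ofReal_norm]
      exact (ENNReal.ofReal_le_ofReal h1).trans (by simp)
    · have := Lp.memLp f
      simp_rw [ENNReal.mul_rpow_of_nonneg _ _ (by norm_num : (0:ℝ) ≤ 2)]
      rw [lintegral_const_mul _ (by fun_prop)]
      refine ENNReal.mul_ne_top (by simp) ?_
      have h2 := this.2
      have := (eLpNorm_lt_top_iff_lintegral_rpow_enorm_lt_top (by norm_num) (by norm_num)).1 h2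
      simpa using this.ne
    · refine Eventually.of_forall fun s => ?_
      have h0 : Tendsto (fun n : ℕ => (1 / ((n:ℝ) + 1) : ℝ)) atTop (𝓝 0) :=
        tendsto_one_div_add_atTop_nhds_zero_nat
      have hc : Continuous (fun d : ℝ => ‖(Complex.exp (-(d : ℂ) * s) - 1) * f s‖ₑ ^ (2:ℝ)) := by
        fun_prop
      have := (hc.tendsto 0).comp h0
      simpa [Function.comp_def] using this
  simp only [key]
  have := (ENNReal.continuous_rpow_const (y := (1/2:ℝ))).tendsto _ |>.comp hlim
  simpa [Function.comp_def] using this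

lemma tsq (T : Lp ℂ 2 m0 →L[ℂ] Lp ℂ 2 m0)
    (hT : ∀ x : Lp ℂ 2 m0, Integrable (⇑x) m0 →
      (⇑(T x) : ℝ → ℂ) =ᵐ[m0] fun t =>
        (Real.sqrt (2 * Real.pi) : ℂ)⁻¹ *
          ∫ ξ in Ioi (0:ℝ), x ξ * Complex.exp (Complex.I * t * ξ))
    (x : Lp ℂ 2 m0) (hx : Integrable x m0) :
    (⇑(T (T x)) : ℝ → ℂ) =ᵐ[m0] fun t =>
      (Complex.I / (2 * Real.pi)) * ∫ ξ, x ξ / (t + ξ) ∂m0 := by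
  have hbd : ∀ d : ℝ, 0 < d → ∀ᵐ (s : ℝ) ∂m0, ‖Complex.exp (-(d:ℂ) * s)‖ ≤ 1 := by
    intro d hd
    filter_upwards [ae_m0_pos] with s hs
    rw [← Complex.ofReal_neg, ← Complex.ofReal_mul, ← Complex.ofReal_exp, Complex.norm_real,
            Real.norm_of_nonneg (Real.exp_pos _).le, Real.exp_le_one_iff]
    nlinarith
  have hmem : ∀ n : ℕ, MemLp (fun s : ℝ => Complex.exp (-((1 / ((n:ℝ) + 1) : ℝ) : ℂ) * s) * (T x) s) 2 m0 := by
    intro n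
    refine (Lp.memLp (T x)).of_le_mul (c := 1) ?_ ?_
    · exact (by fun_prop : Continuous fun s : ℝ => Complex.exp (-((1 / ((n:ℝ) + 1) : ℝ) : ℂ) * s)).aestronglyMeasurable.mul (Lp.aestronglyMeasurable _)
    · filter_upwards [hbd (1 / ((n:ℝ) + 1)) (by positivity)] with s hs
      rw [norm_mul]
      gcongr
  set g : ℕ → Lp ℂ 2 m0 := fun n => (hmem n).toLp with hgdef
  have hg : ∀ n, g n =ᵐ[m0] fun s => Complex.exp (-((1 / ((n:ℝ) + 1) : ℝ) : ℂ) * s) * (T x) s :=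
    fun n => (hmem n).coeFn_toLp
  have hgt := damp_tendsto (T x) g hg
  have hgT : Tendsto (fun n => T (g n)) atTop (𝓝 (T (T x))) := (T.continuous.tendsto _).comp hgt
  obtain ⟨ns, hns, hae⟩ := (tendstoInMeasure_of_tendsto_Lp hgT).exists_seq_tendsto_ae
  have hgint : ∀ n, Integrable (g n) m0 := by
    intro n
    refine Integrable.congr ?_ (hg n).symm
    have hE : MemLp (fun s : ℝ => Complex.exp (-((1 / ((n:ℝ) + 1) : ℝ) : ℂ) * s)) 2 m0 := by
      have hp : (0:ℝ) < 1 / ((n:ℝ) + 1) := by positivity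
      rw [memLp_two_iff_integrable_sq_norm]
      · have := (integrableOn_exp_mul_complex_Ioi (a := -((2 * (1 / ((n:ℝ) + 1)) : ℝ):ℂ)) (by simp only [Complex.neg_re, Complex.ofReal_re]; linarith) 0).norm
        refine Integrable.congr this (Eventually.of_forall fun s => ?_)
        simp only [Complex.norm_exp, ← Real.exp_nat_mul]
        congr 1
        simp; ring
      · exact (by fun_prop : Continuous fun s : ℝ => Complex.exp (-((1 / ((n:ℝ) + 1) : ℝ) : ℂ) * s)).aestronglyMeasurable
    exact hE.integrable_mul (Lp.memLp (T x))
  have hTg : ∀ n, (⇑(T (g n)) : ℝ → ℂ) =ᵐ[m0] fun t => (2 * Real.pi : ℂ)⁻¹ *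
      ∫ ξ, x ξ * (1 / (((1 / ((n:ℝ) + 1) : ℝ) : ℂ) - Complex.I * (t + ξ))) ∂m0 := by
    intro n
    refine (hT (g n) (hgint n)).trans (Eventually.of_forall fun t => ?_)
    simp only
    have : ∫ ξ in Ioi (0:ℝ), (g n) ξ * Complex.exp (Complex.I * t * ξ) =
      ∫ s, (Real.sqrt (2 * Real.pi) : ℂ)⁻¹ * ((Complex.exp (-((1 / ((n:ℝ) + 1) : ℝ) : ℂ) * s) * ∫ ξ, x ξ * Complex.exp (Complex.I * s * ξ) ∂m0)
      * Complex.exp (Complex.I * t * s)) ∂m0 := by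
      change ∫ ξ, (g n) ξ * Complex.exp (Complex.I * t * ξ) ∂m0 = _
      apply integral_congr_ae
      filter_upwards [hg n, hT x hx] with s h1 h2
      rw [h1, h2]
      unfold m0
      ring
    rw [this, integral_const_mul, damp_pointwise x hx _ (by positivity), ← mul_assoc]
    congr 1
    rw [← mul_inv, ← Complex.ofReal_mul, Real.mul_self_sqrt (by positivity)]
    simp
  have hTg' : ∀ᵐ t ∂m0, ∀ n, (T (g n)) t = (2 * Real.pi : ℂ)⁻¹ *
      ∫ ξ, x ξ * (1 / (((1 / ((n:ℝ) + 1) : ℝ) : ℂ) - Complex.I * (t + ξ))) ∂m0 :=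
    ae_all_iff.2 hTg
  filter_upwards [hae, hTg', ae_m0_pos] with t h1 h2 ht
  refine tendsto_nhds_unique h1 ?_
  simp only [h2]
  have hlim : Tendsto (fun n : ℕ => ∫ ξ, x ξ * (1 / (((1 / ((n:ℝ) + 1) : ℝ) : ℂ) - Complex.I * (t + ξ))) ∂m0) atTop (𝓝 (∫ ξ, x ξ * (Complex.I / (t + ξ)) ∂m0)) := by
    refine tendsto_integral_of_dominated_convergence (fun ξ => ‖x ξ‖ * (1/t)) ?_ (hx.norm.mul_const _) ?_ ?_
    · intro n
      refine (Lp.aestronglyMeasurable _).mul ?_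
      exact (by fun_prop : Measurable _).aestronglyMeasurable
    · intro n
      filter_upwards [ae_m0_pos] with ξ hξ
      rw [norm_mul]
      gcongr
      rw [norm_div, norm_one]
      apply one_div_le_one_div_of_le ht
      have := Complex.abs_im_le_norm (((1 / ((n:ℝ) + 1) : ℝ) : ℂ) - Complex.I * (t + ξ))
      refine le_trans ?_ this
      simp only [Complex.sub_im, Complex.ofReal_im, Complex.mul_im, Complex.I_re, Complex.I_im, Complex.add_re, Complex.ofReal_re, Complex.add_im]
      rw [le_abs]; right; linarith
    · filter_upwards [ae_m0_pos] with ξ hξ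
      apply Tendsto.const_mul
      have h0 : Tendsto (fun n : ℕ => (1 / ((n:ℝ) + 1) : ℝ)) atTop (𝓝 0) :=
        tendsto_one_div_add_atTop_nhds_zero_nat
      have hne : ((t:ℂ) + ξ) ≠ 0 := by
        rw [← Complex.ofReal_add, Complex.ofReal_ne_zero]; linarith
      have hc : ContinuousAt (fun d : ℝ => 1 / ((d:ℂ) - Complex.I * (t + ξ))) 0 := by
        apply ContinuousAt.div (by fun_prop) (by fun_prop)
        simp [hne]
      have := hc.tendsto.comp h0
      have he : 1 / (((0:ℝ):ℂ) - Complex.I * (t + ξ)) = Complex.I / (t + ξ) := by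
        have := Complex.I_ne_zero
        rw [div_eq_div_iff (by simp [hne]) hne]
        simp only [Complex.ofReal_zero]
        linear_combination (t+ξ : ℂ) * Complex.I_mul_I
      rw [he] at this
      exact this
  have h3 := (hlim.const_mul (2 * Real.pi : ℂ)⁻¹).comp hns.tendsto_atTop
  have he : (2 * Real.pi : ℂ)⁻¹ * ∫ ξ, x ξ * (Complex.I / (t + ξ)) ∂m0 = (Complex.I / (2 * Real.pi)) * ∫ ξ, x ξ / (t + ξ) ∂m0 := by
    rw [div_eq_mul_inv, mul_comm Complex.I, mul_assoc, ← integral_const_mul Complex.I]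
    congr 2; ext ξ; ring
  rw [← he]
  exact h3

lemma schur_kernel (a : ℝ) (ha : 0 < a) :
    ∫⁻ t, ENNReal.ofReal (√a / (√t * (a + t))) ∂m0 = ENNReal.ofReal Real.pi := by
  have hsa : 0 < √a := Real.sqrt_pos.2 ha
  have hd : ∀ t ∈ Ioi (0:ℝ), HasDerivAt (fun t => 2 * Real.arctan (√t / √a)) (√a / (√t * (a + t))) t := by
    intro t ht
    have ht' : 0 < t := ht
    have hst : 0 < √t := Real.sqrt_pos.2 ht'
    have h := (((Real.hasDerivAt_sqrt ht'.ne').div_const (√a)).arctan).const_mul 2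
    refine h.congr_deriv ?_
    rw [div_pow, Real.sq_sqrt ht'.le, Real.sq_sqrt ha.le]
    field_simp
    rw [Real.sq_sqrt ha.le]
  have hpos : ∀ t ∈ Ioi (0:ℝ), 0 ≤ √a / (√t * (a + t)) := by
    intro t ht
    have ht' : 0 < t := ht
    positivity
  have hlim : Tendsto (fun t => 2 * Real.arctan (√t / √a)) atTop (𝓝 (2 * (Real.pi / 2))) := by
    apply Tendsto.const_mul
    refine (tendsto_nhds_of_tendsto_nhdsWithin Real.tendsto_arctan_atTop).comp ?_
    exact Real.tendsto_sqrt_atTop.atTop_div_const hsa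
  have hcont : ContinuousWithinAt (fun t => 2 * Real.arctan (√t / √a)) (Ici 0) 0 := by
    apply Continuous.continuousWithinAt
    fun_prop
  have hint := integrableOn_Ioi_deriv_of_nonneg hcont hd hpos hlim
  have hval := integral_Ioi_of_hasDerivAt_of_nonneg hcont hd hpos hlim
  unfold m0
  rw [← ofReal_integral_eq_lintegral_ofReal hint, hval]
  · congr 1; simp
    ring
  · exact (ae_restrict_mem measurableSet_Ioi).mono hpos

lemma schur (f : ℝ → ℝ) (hf : Measurable f) :
    ∫⁻ t, ∫⁻ ξ, ENNReal.ofReal (f t * f ξ / (t + ξ)) ∂m0 ∂m0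
      ≤ ENNReal.ofReal Real.pi * ∫⁻ t, ENNReal.ofReal (f t ^ 2) ∂m0 := by
  set k : ℝ → ℝ → ENNReal := fun a t => ENNReal.ofReal (√a / (√t * (a + t))) with hk
  have hkm : Measurable (Function.uncurry k) := by
    simp only [hk, Function.uncurry_def]; fun_prop
  have hpt : ∀ t, 0 < t → ∀ ξ, 0 < ξ → ENNReal.ofReal (f t * f ξ / (t + ξ)) ≤
      ENNReal.ofReal (f t ^ 2 / 2) * k t ξ + ENNReal.ofReal (f ξ ^ 2 / 2) * k ξ t := by
    intro t ht ξ hξ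
    have h1 : 0 < √t := Real.sqrt_pos.2 ht
    have h2 : 0 < √ξ := Real.sqrt_pos.2 hξ
    simp only [hk]
    rw [← ENNReal.ofReal_mul (by positivity), ← ENNReal.ofReal_mul (by positivity),
      ← ENNReal.ofReal_add (by positivity) (by positivity)]
    apply ENNReal.ofReal_le_ofReal
    have e : f t ^ 2 / 2 * (√t / (√ξ * (t + ξ))) + f ξ ^ 2 / 2 * (√ξ / (√t * (ξ + t)))
      - f t * f ξ / (t + ξ) = (f t * √t - f ξ * √ξ) ^ 2 / (2 * √t * √ξ * (t + ξ)) := by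
      rw [add_comm ξ t]
      field_simp
      ring
    have : 0 ≤ (f t * √t - f ξ * √ξ) ^ 2 / (2 * √t * √ξ * (t + ξ)) := by positivity
    linarith
  have e1 : ∀ᵐ t ∂m0, ∫⁻ ξ, ENNReal.ofReal (f t ^ 2 / 2) * k t ξ ∂m0 = ENNReal.ofReal (f t ^ 2 / 2) * ENNReal.ofReal Real.pi := by
    filter_upwards [ae_m0_pos] with t ht
    rw [lintegral_const_mul _ (by simp only [hk]; fun_prop), schur_kernel t ht]
  calc _ ≤ ∫⁻ t, ∫⁻ ξ, (ENNReal.ofReal (f t ^ 2 / 2) * k t ξ + ENNReal.ofReal (f ξ ^ 2 / 2) * k ξ t) ∂m0 ∂m0 := by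
        apply lintegral_mono_ae
        filter_upwards [ae_m0_pos] with t ht
        apply lintegral_mono_ae
        filter_upwards [ae_m0_pos] with ξ hξ
        exact hpt t ht ξ hξ
    _ = ∫⁻ t, ∫⁻ ξ, ENNReal.ofReal (f t ^ 2 / 2) * k t ξ ∂m0 ∂m0 + ∫⁻ t, ∫⁻ ξ, ENNReal.ofReal (f ξ ^ 2 / 2) * k ξ t ∂m0 ∂m0 := by
        rw [← lintegral_add_left]
        · congr 1; ext t
          rw [lintegral_add_left]
          simp only [hk]; fun_prop
        · apply Measurable.lintegral_prod_right' (f := fun z : ℝ × ℝ => ENNReal.ofReal (f z.1 ^ 2 / 2) * k z.1 z.2)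
          simp only [hk]; fun_prop
    _ = ∫⁻ t, ∫⁻ ξ, ENNReal.ofReal (f t ^ 2 / 2) * k t ξ ∂m0 ∂m0 + ∫⁻ t, ∫⁻ ξ, ENNReal.ofReal (f t ^ 2 / 2) * k t ξ ∂m0 ∂m0 := by
        congr 1
        rw [lintegral_lintegral_swap]
        apply Measurable.aemeasurable
        simp only [hk, Function.uncurry_def]; fun_prop
    _ = ENNReal.ofReal Real.pi * ∫⁻ t, ENNReal.ofReal (f t ^ 2) ∂m0 := by
        rw [lintegral_congr_ae e1, lintegral_mul_const _ (by fun_prop), ← add_mul, mul_comm,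
          ← lintegral_add_left (by fun_prop)]
        congr 2; ext t
        rw [← ENNReal.ofReal_add (by positivity) (by positivity)]
        congr 1; ring

lemma quad_integrable (g : ℝ → ℂ) (hg : Measurable g) (h2 : MemLp g 2 m0) :
    Integrable (fun z : ℝ × ℝ => ‖g z.1‖ * ‖g z.2‖ / (z.1 + z.2)) (m0.prod m0) ∧
    ∫ z : ℝ × ℝ, ‖g z.1‖ * ‖g z.2‖ / (z.1 + z.2) ∂(m0.prod m0) ≤ Real.pi * ∫ t, ‖g t‖ ^ 2 ∂m0 := by
  have hs := schur (fun t => ‖g t‖) hg.norm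
  have hm : Measurable (fun z : ℝ × ℝ => ‖g z.1‖ * ‖g z.2‖ / (z.1 + z.2)) := by fun_prop
  have hae : ∀ᵐ z ∂(m0.prod m0), 0 < z.1 ∧ 0 < z.2 := by
    have a := Measure.quasiMeasurePreserving_fst (μ := m0) (ν := m0) |>.ae ae_m0_pos
    have b := Measure.quasiMeasurePreserving_snd (μ := m0) (ν := m0) |>.ae ae_m0_pos
    filter_upwards [a, b] with z h1 h2 using ⟨h1, h2⟩
  have hnn : 0 ≤ᵐ[m0.prod m0] (fun z : ℝ × ℝ => ‖g z.1‖ * ‖g z.2‖ / (z.1 + z.2)) := by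
    filter_upwards [hae] with z hz
    have := hz.1; have := hz.2
    simp only [Pi.zero_apply]
    positivity
  have hsq : Integrable (fun t => ‖g t‖ ^ 2) m0 :=
    (memLp_two_iff_integrable_sq_norm h2.1).1 h2
  have e0 : ∫⁻ t, ENNReal.ofReal (‖g t‖ ^ 2) ∂m0 = ENNReal.ofReal (∫ t, ‖g t‖ ^ 2 ∂m0) := by
    rw [ofReal_integral_eq_lintegral_ofReal hsq (Eventually.of_forall fun t => by positivity)]
  have e1 : ∫⁻ z : ℝ × ℝ, ENNReal.ofReal (‖g z.1‖ * ‖g z.2‖ / (z.1 + z.2)) ∂(m0.prod m0) ≤ ENNReal.ofReal (Real.pi * ∫ t, ‖g t‖ ^ 2 ∂m0) := by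
    rw [lintegral_prod _ (by fun_prop), ENNReal.ofReal_mul Real.pi_pos.le, ← e0]
    exact hs
  have hint : Integrable (fun z : ℝ × ℝ => ‖g z.1‖ * ‖g z.2‖ / (z.1 + z.2)) (m0.prod m0) := by
    refine ⟨hm.aestronglyMeasurable, ?_⟩
    rw [hasFiniteIntegral_iff_ofReal hnn]
    exact e1.trans_lt ENNReal.ofReal_lt_top
  refine ⟨hint, ?_⟩
  rw [← ofReal_integral_eq_lintegral_ofReal hint hnn] at e1
  refine (ENNReal.ofReal_le_ofReal_iff ?_).1 e1
  have : 0 ≤ ∫ t, ‖g t‖ ^ 2 ∂m0 := integral_nonneg fun t => by positivity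
  have := Real.pi_pos
  positivity

lemma quad (g : ℝ → ℂ) (hg : Measurable g) (h2 : MemLp g 2 m0) :
    ∃ q : ℝ, 0 ≤ q ∧ q ≤ Real.pi * ∫ t, ‖g t‖ ^ 2 ∂m0 ∧
     ∫ t, g t * ∫ ξ, (starRingEnd ℂ) (g ξ) / (t + ξ) ∂m0 ∂m0 = q := by
  obtain ⟨hI, hb⟩ := quad_integrable g hg h2
  have hae : ∀ᵐ z ∂(m0.prod m0), 0 < z.1 ∧ 0 < z.2 := by
    have a := Measure.quasiMeasurePreserving_fst (μ := m0) (ν := m0) |>.ae ae_m0_pos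
    have b := Measure.quasiMeasurePreserving_snd (μ := m0) (ν := m0) |>.ae ae_m0_pos
    filter_upwards [a, b] with z h1 h2 using ⟨h1, h2⟩
  have hstar : Measurable fun t => (starRingEnd ℂ) (g t) := Complex.continuous_conj.measurable.comp hg
  have hIc : Integrable (fun z : ℝ × ℝ => g z.1 * (starRingEnd ℂ) (g z.2) / (z.1 + z.2)) (m0.prod m0) := by
    refine hI.mono' (by fun_prop : Measurable _).aestronglyMeasurable ?_
    filter_upwards [hae] with z hz
    rw [norm_div, norm_mul, RCLike.norm_conj, ← Complex.ofReal_add, Complex.norm_real,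
      Real.norm_of_nonneg (by linarith [hz.1, hz.2])]
  have e1 : ∫ t, g t * ∫ ξ, (starRingEnd ℂ) (g ξ) / (t + ξ) ∂m0 ∂m0 =
      ∫ z : ℝ × ℝ, g z.1 * (starRingEnd ℂ) (g z.2) / (z.1 + z.2) ∂(m0.prod m0) := by
    rw [integral_prod _ hIc]
    congr 1; ext t
    rw [← integral_const_mul]
    congr 1; ext ξ
    simp only
    ring
  have hlap : ∀ a : ℝ, 0 < a → ∫ u, Real.exp (-a * u) ∂m0 = 1 / a := by
    intro a ha
    unfold m0
    rw [integral_exp_mul_Ioi (by linarith)]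
    simp
  have hlapi : ∀ a : ℝ, 0 < a → Integrable (fun u => Real.exp (-a * u)) m0 := by
    intro a ha
    exact integrableOn_exp_mul_Ioi (by linarith) 0
  have hF : Integrable (Function.uncurry fun (z : ℝ × ℝ) (u : ℝ) =>
     g z.1 * (starRingEnd ℂ) (g z.2) * ((Real.exp (-(z.1 + z.2) * u) : ℝ) : ℂ)) ((m0.prod m0).prod m0) := by
    have hms : Measurable (Function.uncurry fun (z : ℝ × ℝ) (u : ℝ) =>
     g z.1 * (starRingEnd ℂ) (g z.2) * ((Real.exp (-(z.1 + z.2) * u) : ℝ) : ℂ)) := by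
      simp only [Function.uncurry_def]
      fun_prop
    rw [integrable_prod_iff hms.aestronglyMeasurable]
    constructor
    · filter_upwards [hae] with z hz
      have h := ((hlapi (z.1 + z.2) (by linarith [hz.1, hz.2])).ofReal (𝕜 := ℂ)).const_mul (g z.1 * (starRingEnd ℂ) (g z.2))
      exact h
    · refine hI.congr ?_
      filter_upwards [hae] with z hz
      simp only [Function.uncurry, norm_mul, RCLike.norm_conj, Complex.norm_real]
      rw [integral_const_mul]
      simp only [Real.norm_of_nonneg (Real.exp_pos _).le]
      rw [hlap (z.1 + z.2) (by linarith [hz.1, hz.2])]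
      ring
  have e2 : ∫ z : ℝ × ℝ, g z.1 * (starRingEnd ℂ) (g z.2) / (z.1 + z.2) ∂(m0.prod m0) =
      ((∫ u, ‖∫ t, g t * ((Real.exp (-t * u) : ℝ) : ℂ) ∂m0‖ ^ 2 ∂m0 : ℝ) : ℂ) := by
    calc _ = ∫ z : ℝ × ℝ, ∫ u, g z.1 * (starRingEnd ℂ) (g z.2) * ((Real.exp (-(z.1 + z.2) * u) : ℝ) : ℂ) ∂m0 ∂(m0.prod m0) := by
          apply integral_congr_ae
          filter_upwards [hae] with z hz
          rw [integral_const_mul, integral_complex_ofReal, hlap (z.1 + z.2) (by linarith [hz.1, hz.2])]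
          push_cast
          ring
      _ = ∫ u, ∫ z : ℝ × ℝ, g z.1 * (starRingEnd ℂ) (g z.2) * ((Real.exp (-(z.1 + z.2) * u) : ℝ) : ℂ) ∂(m0.prod m0) ∂m0 :=
          integral_integral_swap hF
      _ = _ := by
          rw [← integral_complex_ofReal]
          congr 1; ext u
          have : ∀ z : ℝ × ℝ, g z.1 * (starRingEnd ℂ) (g z.2) * ((Real.exp (-(z.1 + z.2) * u) : ℝ) : ℂ)
            = (g z.1 * ((Real.exp (-z.1 * u) : ℝ) : ℂ)) * (starRingEnd ℂ) (g z.2 * ((Real.exp (-z.2 * u) : ℝ) : ℂ)) := by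
            intro z
            rw [map_mul, Complex.conj_ofReal, show -(z.1 + z.2) * u = -z.1 * u + -z.2 * u by ring, Real.exp_add]
            push_cast
            ring
          simp_rw [this]
          rw [integral_prod_mul (fun t => g t * ((Real.exp (-t * u) : ℝ) : ℂ)) (fun t => (starRingEnd ℂ) (g t * ((Real.exp (-t * u) : ℝ) : ℂ))), integral_conj, RCLike.mul_conj]
          push_cast
          rfl
  refine ⟨∫ u, ‖∫ t, g t * ((Real.exp (-t * u) : ℝ) : ℂ) ∂m0‖ ^ 2 ∂m0, integral_nonneg fun t => by positivity, ?_, e1.trans e2⟩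
  have h3 : ‖∫ z : ℝ × ℝ, g z.1 * (starRingEnd ℂ) (g z.2) / (z.1 + z.2) ∂(m0.prod m0)‖ ≤ ∫ z : ℝ × ℝ, ‖g z.1‖ * ‖g z.2‖ / (z.1 + z.2) ∂(m0.prod m0) := by
    refine norm_integral_le_of_norm_le hI ?_
    filter_upwards [hae] with z hz
    rw [norm_div, norm_mul, RCLike.norm_conj, ← Complex.ofReal_add, Complex.norm_real,
      Real.norm_of_nonneg (by linarith [hz.1, hz.2])]
  rw [e2, Complex.norm_real] at h3
  exact (le_abs_self _).trans (h3.trans hb)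

def FT (T : Lp ℂ 2 m0 →L[ℂ] Lp ℂ 2 m0) : Prop :=
    ∀ x : Lp ℂ 2 m0, Integrable (⇑x) m0 →
      (⇑(T x) : ℝ → ℂ) =ᵐ[m0] fun t =>
        (Real.sqrt (2 * Real.pi) : ℂ)⁻¹ *
          ∫ ξ in Ioi (0:ℝ), x ξ * Complex.exp (Complex.I * t * ξ)

lemma norm_sq_Lp (x : Lp ℂ 2 m0) : ‖x‖ ^ 2 = ∫ t, ‖x t‖ ^ 2 ∂m0 := by
  have h := L2.inner_def (𝕜 := ℂ) x x
  rw [inner_self_eq_norm_sq_to_K] at h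
  simp only [inner_self_eq_norm_sq_to_K] at h
  simp only [Complex.coe_algebraMap] at h
  simp only [← Complex.ofReal_pow] at h
  rw [integral_complex_ofReal] at h
  exact_mod_cast h

lemma form_int (T : Lp ℂ 2 m0 →L[ℂ] Lp ℂ 2 m0) (hT : FT T) (x : Lp ℂ 2 m0) (hx : Integrable x m0) :
    (inner ℂ (((-Complex.I) • (T ^ 2)) x) x).im = 0 ∧ 0 ≤ (inner ℂ (((-Complex.I) • (T ^ 2)) x) x).re ∧
    (inner ℂ (((-Complex.I) • (T ^ 2)) x) x).re ≤ 1 / 2 * ‖x‖ ^ 2 := by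
  obtain ⟨q, h0, h1, h2⟩ := quad x (Lp.stronglyMeasurable x).measurable (Lp.memLp x)
  have hn := norm_sq_Lp x
  have key : inner ℂ (((-Complex.I) • (T ^ 2)) x) x = ((q / (2 * Real.pi) : ℝ) : ℂ) := by
    rw [L2.inner_def]
    have : ∀ᵐ t ∂m0, inner ℂ ((((-Complex.I) • (T ^ 2)) x : Lp ℂ 2 m0) t) (x t) =
       (2 * Real.pi : ℂ)⁻¹ * (x t * ∫ ξ, (starRingEnd ℂ) (x ξ) / (t + ξ) ∂m0) := by
      have e : ((-Complex.I) • (T ^ 2)) x = (-Complex.I) • (T (T x)) := by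
        rw [pow_two]; rfl
      rw [e]
      filter_upwards [Lp.coeFn_smul (-Complex.I) (T (T x)), tsq T hT x hx] with t h3 h4
      rw [h3, Pi.smul_apply, h4, RCLike.inner_apply, smul_eq_mul]
      have e2 : (∫ ξ, (starRingEnd ℂ) (x ξ) / (t + ξ) ∂m0) = (starRingEnd ℂ) (∫ ξ, x ξ / (t + ξ) ∂m0) := by
        rw [← integral_conj]
        congr 1; ext ξ
        rw [map_div₀, map_add, Complex.conj_ofReal, Complex.conj_ofReal]
      rw [e2, ← mul_assoc (-Complex.I), map_mul]
      have e3 : -Complex.I * (Complex.I / (2 * Real.pi)) = (((2 * Real.pi)⁻¹ : ℝ) : ℂ) := by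
        push_cast
        linear_combination (-(2 * Real.pi : ℂ)⁻¹) * Complex.I_mul_I
      rw [e3, Complex.conj_ofReal]
      push_cast
      ring
    rw [integral_congr_ae this, integral_const_mul, h2]
    push_cast
    ring
  rw [key]
  have := Real.pi_pos
  refine ⟨Complex.ofReal_im _, by rw [Complex.ofReal_re]; positivity, ?_⟩
  rw [Complex.ofReal_re, hn, div_le_iff₀ (by positivity)]
  linarith

lemma form_all (T : Lp ℂ 2 m0 →L[ℂ] Lp ℂ 2 m0) (hT : FT T) (x : Lp ℂ 2 m0) :
    (inner ℂ (((-Complex.I) • (T ^ 2)) x) x).im = 0 ∧ 0 ≤ (inner ℂ (((-Complex.I) • (T ^ 2)) x) x).re ∧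
    (inner ℂ (((-Complex.I) • (T ^ 2)) x) x).re ≤ 1 / 2 * ‖x‖ ^ 2 := by
  refine (Lp.simpleFunc.denseRange (E := ℂ) (p := 2) (μ := m0) (by norm_num)).induction_on x ?_ ?_
  · have hc : Continuous fun x : Lp ℂ 2 m0 => inner ℂ (((-Complex.I) • (T ^ 2)) x) x := by fun_prop
    exact (isClosed_eq (Complex.continuous_im.comp hc) continuous_const).inter
      ((isClosed_le continuous_const (Complex.continuous_re.comp hc)).inter
      (isClosed_le (Complex.continuous_re.comp hc) (by fun_prop)))
  · intro f
    apply form_int T hT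
    have h1 := Lp.simpleFunc.toSimpleFunc_eq_toFun f
    refine Integrable.congr ?_ h1
    exact (SimpleFunc.memLp_iff_integrable (by norm_num) (by norm_num)).1 (Lp.simpleFunc.memLp f)

lemma spec_nonneg {E : Type*} [NormedAddCommGroup E] [InnerProductSpace ℂ E] [CompleteSpace E]
    (A : E →L[ℂ] E) (h : 0 ≤ A) (z : ℂ) (hz : z ∈ spectrum ℂ A) : 0 ≤ z.re ∧ z.im = 0 := by
  have hs : IsSelfAdjoint A := .of_nonneg h
  have e := hs.mem_spectrum_eq_re hz
  have : z.re ∈ spectrum ℝ A := by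
    rw [← spectrum.algebraMap_mem_iff ℂ]; rw [e] at hz; exact hz
  exact ⟨spectrum_nonneg_of_nonneg h this, by rw [e]; simp⟩

lemma spec_upper (T : Lp ℂ 2 m0 →L[ℂ] Lp ℂ 2 m0) (hT : FT T) (z : ℂ) (hz : z ∈ spectrum ℂ T) :
    ∃ r : ℝ, 0 ≤ r ∧ r ≤ 1 / 2 ∧ z ^ 2 = Complex.I * r := by
  set A := (-Complex.I) • (T ^ 2) with hA
  have hz2 : -Complex.I * z ^ 2 ∈ spectrum ℂ A := by
    have h := spectrum.pow_mem_pow T 2 hz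
    have h2 := (spectrum.smul_mem_smul_iff (r := Units.mk0 (-Complex.I) (by simp))).2 h
    exact h2
  have hpos : 0 ≤ A := by
    rw [ContinuousLinearMap.nonneg_iff_isPositive, ContinuousLinearMap.isPositive_iff_complex]
    intro x
    obtain ⟨h1, h2, h3⟩ := form_all T hT x
    refine ⟨?_, h2⟩
    apply Complex.ext
    · simp
    · rw [h1]; exact Complex.ofReal_im _
  have hpos2 : 0 ≤ algebraMap ℂ (Lp ℂ 2 m0 →L[ℂ] Lp ℂ 2 m0) (1/2) - A := by
    rw [ContinuousLinearMap.nonneg_iff_isPositive, ContinuousLinearMap.isPositive_iff_complex]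
    intro x
    obtain ⟨h1, h2, h3⟩ := form_all T hT x
    have e : inner ℂ ((algebraMap ℂ (Lp ℂ 2 m0 →L[ℂ] Lp ℂ 2 m0) (1/2) - A) x) x =
       ((1 / 2 * ‖x‖ ^ 2 : ℝ) : ℂ) - inner ℂ (A x) x := by
      rw [sub_apply, inner_sub_left, Algebra.algebraMap_eq_smul_one, smul_apply, one_apply_eq_self, inner_smul_left,
        inner_self_eq_norm_sq_to_K]
      have : (starRingEnd ℂ) (1 / 2) = ((1 / 2 : ℝ) : ℂ) := by
        rw [← Complex.conj_ofReal]; norm_num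
      rw [this]
      push_cast
      rfl
    rw [e]
    refine ⟨?_, ?_⟩
    · apply Complex.ext
      · simp
      · simp only [RCLike.re_to_complex, Complex.ofReal_im, Complex.sub_im]
        rw [h1]; simp
    · simp only [RCLike.re_to_complex, Complex.sub_re, Complex.ofReal_re]
      linarith
  have hz3 : 1 / 2 - -Complex.I * z ^ 2 ∈ spectrum ℂ (algebraMap ℂ (Lp ℂ 2 m0 →L[ℂ] Lp ℂ 2 m0) (1/2) - A) := by
    rw [← spectrum.singleton_sub_eq]
    exact Set.sub_mem_sub rfl hz2
  obtain ⟨a1, a2⟩ := spec_nonneg A hpos _ hz2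
  obtain ⟨b1, b2⟩ := spec_nonneg _ hpos2 _ hz3
  refine ⟨(-Complex.I * z ^ 2).re, a1, ?_, ?_⟩
  · rw [Complex.sub_re] at b1
    norm_num at b1 ⊢
    linarith
  · have : ((-Complex.I * z ^ 2).re : ℂ) = -Complex.I * z ^ 2 := by
      apply Complex.ext
      · simp
      · rw [a2]; simp
    rw [this]
    linear_combination (z ^ 2) * Complex.I_mul_I

lemma mem_spec_of_approx (T : Lp ℂ 2 m0 →L[ℂ] Lp ℂ 2 m0) (l : ℂ) (hl : l ≠ 0) (C : ℝ)
    (h : ∀ N : ℝ, 1 ≤ N → ∃ g : Lp ℂ 2 m0, ‖g‖ = N ∧ ‖T (T g) - l ^ 2 • g‖ ≤ C ∧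
      ‖inner ℂ (T g) g‖ ≤ C) : l ∈ spectrum ℂ T := by
  by_contra hcon
  rw [spectrum.notMem_iff] at hcon
  obtain ⟨u, hu⟩ := hcon
  set S : Lp ℂ 2 m0 →L[ℂ] Lp ℂ 2 m0 := ↑u⁻¹ with hS
  have hSi : ∀ v, S (l • v - T v) = v := by
    intro v
    have h1 : S * (u : Lp ℂ 2 m0 →L[ℂ] Lp ℂ 2 m0) = 1 := u.inv_mul
    have h2 := DFunLike.congr_fun h1 v
    rw [hu] at h2
    exact h2
  have hC : 0 ≤ C := by
    obtain ⟨g, _, h2, _⟩ := h 1 le_rfl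
    exact (norm_nonneg _).trans h2
  have hl' : 0 < ‖l‖ := norm_pos_iff.2 hl
  set N : ℝ := 1 + (‖S‖ * C + C) / ‖l‖ with hN
  have hN1 : 1 ≤ N := by
    have : 0 ≤ (‖S‖ * C + C) / ‖l‖ := by positivity
    linarith
  obtain ⟨g, g1, g2, g3⟩ := h N hN1
  have hv : ‖l • g + T g‖ ≤ ‖S‖ * C := by
    have e : l • (l • g + T g) - T (l • g + T g) = -(T (T g) - l ^ 2 • g) := by
      rw [map_add, map_smul, smul_add, smul_smul, pow_two]
      abel
    have h1 := hSi (l • g + T g)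
    rw [← h1, e]
    refine (S.le_opNorm _).trans ?_
    rw [norm_neg]
    gcongr
  have h1 : ‖inner ℂ (l • g + T g) g‖ ≤ ‖S‖ * C * N := by
    refine (norm_inner_le_norm _ _).trans ?_
    rw [g1]; gcongr
  have h2 : ‖l‖ * N ^ 2 ≤ ‖inner ℂ (l • g + T g) g‖ + ‖inner ℂ (T g) g‖ := by
    have e : inner ℂ (l • g) g = inner ℂ (l • g + T g) g - inner ℂ (T g) g := by
      rw [inner_add_left]; ring
    have e2 : ‖inner ℂ (l • g) g‖ = ‖l‖ * N ^ 2 := by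
      rw [inner_smul_left, norm_mul, RCLike.norm_conj, inner_self_eq_norm_sq_to_K, g1]
      simp
    rw [← e2, e]
    exact norm_sub_le _ _
  have h3 : ‖l‖ * N = ‖l‖ + (‖S‖ * C + C) := by
    rw [hN]; field_simp
  have h4 : ‖l‖ * N ^ 2 ≤ ‖S‖ * C * N + C := by linarith
  have h5 : ‖l‖ * N ^ 2 = ‖l‖ * N + ‖S‖ * C * N + C * N := by
    linear_combination N * h3
  nlinarith

lemma int_P (a : ℝ) (ha : 0 < a) : IntegrableOn (fun t : ℝ => t ^ (-(1/2) : ℝ)) (Ioc 0 a) ∧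
    ∫ t in Ioc 0 a, t ^ (-(1/2) : ℝ) = 2 * √a := by
  constructor
  · rw [← intervalIntegrable_iff_integrableOn_Ioc_of_le ha.le]
    exact intervalIntegral.intervalIntegrable_rpow' (by norm_num)
  · rw [← intervalIntegral.integral_of_le ha.le, integral_rpow (by left; norm_num)]
    rw [Real.sqrt_eq_rpow]
    norm_num
    ring

lemma int_Q (a : ℝ) (ha : 0 < a) : IntegrableOn (fun t : ℝ => t ^ (-(3/2) : ℝ)) (Ioi a) ∧
    ∫ t in Ioi a, t ^ (-(3/2) : ℝ) = 2 / √a := by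
  constructor
  · exact integrableOn_Ioi_rpow_of_lt (by norm_num) ha
  · rw [integral_Ioi_rpow_of_lt (by norm_num) ha]
    have : (-(3/2) + 1 : ℝ) = -(1/2) := by norm_num
    rw [this, Real.rpow_neg ha.le, Real.sqrt_eq_rpow]
    field_simp

lemma int_R (a : ℝ) (ha : 0 < a) : IntegrableOn (fun t : ℝ => 1 / t ^ 2) (Ioi a) ∧
    ∫ t in Ioi a, 1 / t ^ 2 = 1 / a := by
  have e : ∀ t ∈ Ioi a, t ^ (-2 : ℝ) = 1 / t ^ 2 := by
    intro t ht
    have : 0 < t := lt_trans ha ht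
    rw [Real.rpow_neg this.le, one_div]; norm_cast
  constructor
  · exact (integrableOn_Ioi_rpow_of_lt (by norm_num) ha).congr_fun e measurableSet_Ioi
  · rw [← setIntegral_congr_fun measurableSet_Ioi e, integral_Ioi_rpow_of_lt (by norm_num) ha]
    norm_num
    rw [Real.rpow_neg ha.le, Real.rpow_one]

noncomputable def cw (w : ℝ) : ℂ := -(1/2) + Complex.I * w

lemma norm_cpow (w t : ℝ) (ht : 0 < t) : ‖(t : ℂ) ^ cw w‖ = t ^ (-(1/2) : ℝ) := by
  rw [Complex.norm_cpow_eq_rpow_re_of_pos ht]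
  congr 1
  simp [cw]

lemma meas_cpow (w : ℝ) : Measurable (fun t : ℝ => (t : ℂ) ^ cw w) := by
  fun_prop

lemma int_kernel (x : ℝ) (hx : 0 < x) :
    Integrable (fun t : ℝ => t ^ (-(1/2) : ℝ) / (x + t)) m0 := by
  have h : Integrable (fun t : ℝ => √x / (√t * (x + t))) m0 := by
    refine ⟨(by fun_prop : Measurable _).aestronglyMeasurable, ?_⟩
    rw [hasFiniteIntegral_iff_ofReal]
    · rw [schur_kernel x hx]; exact ENNReal.ofReal_lt_top
    · filter_upwards [ae_m0_pos] with t ht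
      simp only [Pi.zero_apply]
      positivity
  refine (h.const_mul (1 / √x)).congr ?_
  filter_upwards [ae_m0_pos] with t ht
  have : 0 < √x := Real.sqrt_pos.2 hx
  have : 0 < √t := Real.sqrt_pos.2 ht
  rw [Real.rpow_neg ht.le, ← Real.sqrt_eq_rpow]
  field_simp

lemma mellin_kernel (w x : ℝ) (hx : 0 < x) :
    Integrable (fun t : ℝ => (t : ℂ) ^ cw w / (x + t)) m0 ∧
    ∫ t : ℝ, (t : ℂ) ^ cw w / (x + t) ∂m0 = (Real.pi / Real.cosh (Real.pi * w) : ℝ) * (x : ℂ) ^ cw w := by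
  have hnorm : ∀ᵐ t : ℝ ∂m0, ‖(t : ℂ) ^ cw w / (x + t)‖ = t ^ (-(1/2) : ℝ) / (x + t) := by
    filter_upwards [ae_m0_pos] with t ht
    rw [norm_div, norm_cpow w t ht, ← Complex.ofReal_add, Complex.norm_real, Real.norm_of_nonneg (by linarith)]
  refine ⟨(int_kernel x hx).mono' ((meas_cpow w).div (by fun_prop)).aestronglyMeasurable (hnorm.mono fun t h => h.le), ?_⟩
  have hlap : ∀ a : ℝ, 0 < a → ∫ u, Real.exp (-a * u) ∂m0 = 1 / a := by
    intro a ha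
    unfold m0
    rw [integral_exp_mul_Ioi (by linarith)]
    simp
  have hlapi : ∀ a : ℝ, 0 < a → Integrable (fun u => Real.exp (-a * u)) m0 := by
    intro a ha
    exact integrableOn_exp_mul_Ioi (by linarith) 0
  have hF : Integrable (Function.uncurry fun (t u : ℝ) =>
     (t : ℂ) ^ cw w * ((Real.exp (-(x + t) * u) : ℝ) : ℂ)) (m0.prod m0) := by
    have hms : Measurable (Function.uncurry fun (t u : ℝ) =>
      (t : ℂ) ^ cw w * ((Real.exp (-(x + t) * u) : ℝ) : ℂ)) := by
      simp only [Function.uncurry_def]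
      exact ((meas_cpow w).comp measurable_fst).mul (by fun_prop)
    rw [integrable_prod_iff hms.aestronglyMeasurable]
    constructor
    · filter_upwards [ae_m0_pos] with t ht
      have h := ((hlapi (x + t) (by linarith)).ofReal (𝕜 := ℂ)).const_mul ((t : ℂ) ^ cw w)
      exact h
    · refine (int_kernel x hx).congr ?_
      filter_upwards [ae_m0_pos] with t ht
      simp only [Function.uncurry, norm_mul, Complex.norm_real]
      rw [integral_const_mul]
      simp only [Real.norm_of_nonneg (Real.exp_pos _).le]
      rw [hlap (x + t) (by linarith), norm_cpow w t ht]
      ring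
  have hre : (cw w + 1).re = 1 / 2 := by simp [cw]; norm_num
  have hre' : (-cw w).re = 1 / 2 := by simp [cw]
  calc ∫ t : ℝ, (t : ℂ) ^ cw w / (x + t) ∂m0
      = ∫ t : ℝ, ∫ u : ℝ, (t : ℂ) ^ cw w * ((Real.exp (-(x + t) * u) : ℝ) : ℂ) ∂m0 ∂m0 := by
        apply integral_congr_ae
        filter_upwards [ae_m0_pos] with t ht
        rw [integral_const_mul, integral_complex_ofReal, hlap (x + t) (by linarith)]
        push_cast
        ring
    _ = ∫ u : ℝ, ∫ t : ℝ, (t : ℂ) ^ cw w * ((Real.exp (-(x + t) * u) : ℝ) : ℂ) ∂m0 ∂m0 :=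
        integral_integral_swap hF
    _ = ∫ u : ℝ, Complex.Gamma (cw w + 1) * ((u : ℂ) ^ ((-cw w) - 1) * Complex.exp (-(x * u))) ∂m0 := by
        apply integral_congr_ae
        filter_upwards [ae_m0_pos] with u hu
        have h := Complex.integral_cpow_mul_exp_neg_mul_Ioi (a := cw w + 1) (r := u) (by rw [hre]; norm_num) hu
        have e : ∀ t : ℝ, (t : ℂ) ^ cw w * ((Real.exp (-(x + t) * u) : ℝ) : ℂ) =
           Complex.exp (-(x * u)) * ((t : ℂ) ^ (cw w + 1 - 1) * Complex.exp (-(u * t))) := by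
          intro t
          rw [add_sub_cancel_right, mul_left_comm, ← Complex.exp_add]
          push_cast
          congr 2
          ring
        simp_rw [e]
        rw [integral_const_mul]
        unfold m0
        rw [h, one_div, Complex.inv_cpow, ← Complex.cpow_neg]
        · rw [neg_add, ← sub_eq_add_neg]
          ring
        · rw [Complex.arg_ofReal_of_nonneg hu.le]; exact Real.pi_pos.ne
    _ = _ := by
        rw [integral_const_mul]
        unfold m0
        rw [Complex.integral_cpow_mul_exp_neg_mul_Ioi (by rw [hre']; norm_num) hx]
        have hG : Complex.Gamma (cw w + 1) * Complex.Gamma (-cw w) = (Real.pi / Real.cosh (Real.pi * w) : ℝ) := by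
          have := Complex.Gamma_mul_Gamma_one_sub (cw w + 1)
          rw [show 1 - (cw w + 1) = -cw w by ring] at this
          rw [this]
          push_cast
          congr 1
          rw [show (Real.pi : ℂ) * (cw w + 1) = Real.pi * w * Complex.I + Real.pi / 2 by unfold cw; ring]
          rw [Complex.sin_add_pi_div_two, Complex.cos_mul_I]
        rw [← hG, one_div, Complex.inv_cpow, ← Complex.cpow_neg, neg_neg]
        · ring
        · rw [Complex.arg_ofReal_of_nonneg hx.le]; exact Real.pi_pos.ne

noncomputable def gR (w R : ℝ) : ℝ → ℂ := (Ioc 1 R).indicator (fun t : ℝ => (t : ℂ) ^ cw w)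

lemma meas_gR (w R : ℝ) : Measurable (gR w R) := (meas_cpow w).indicator measurableSet_Ioc

lemma m0_restrict (S : Set ℝ) (hS : MeasurableSet S) (h : S ⊆ Ioi 0) : m0.restrict S = volume.restrict S := by
  unfold m0
  rw [Measure.restrict_restrict hS, inter_eq_left.2 h]

lemma int_gR_kernel (w R x : ℝ) : ∫ t, gR w R t / (x + t) ∂m0 = ∫ t in Ioc 1 R, (t : ℂ) ^ cw w / (x + t) := by
  have h : (fun t => gR w R t / (x + t)) = (Ioc 1 R).indicator (fun t : ℝ => (t : ℂ) ^ cw w / (x + t)) := by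
    ext t
    unfold gR
    by_cases ht : t ∈ Ioc 1 R <;> simp [ht]
  rw [h, integral_indicator measurableSet_Ioc, m0_restrict _ measurableSet_Ioc]
  intro t ht
  exact lt_trans one_pos ht.1

lemma kernel_norm (w x t : ℝ) (hx : 0 < x) (ht : 0 < t) :
    ‖(t : ℂ) ^ cw w / (x + t)‖ = t ^ (-(1/2) : ℝ) / (x + t) := by
  rw [norm_div, norm_cpow w t ht, ← Complex.ofReal_add, Complex.norm_real, Real.norm_of_nonneg (by linarith)]

lemma kernel_le1 (w x t : ℝ) (hx : 0 < x) (ht : 0 < t) :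
    ‖(t : ℂ) ^ cw w / (x + t)‖ ≤ t ^ (-(1/2) : ℝ) * (1 / x) := by
  rw [kernel_norm w x t hx ht, div_eq_mul_one_div]
  have : 0 ≤ t ^ (-(1/2) : ℝ) := Real.rpow_nonneg ht.le _
  gcongr
  linarith

lemma kernel_le2 (w x t : ℝ) (hx : 0 < x) (ht : 0 < t) :
    ‖(t : ℂ) ^ cw w / (x + t)‖ ≤ t ^ (-(3/2) : ℝ) := by
  rw [kernel_norm w x t hx ht]
  have e : t ^ (-(3/2) : ℝ) = t ^ (-(1/2) : ℝ) / t := by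
    rw [← Real.rpow_sub_one ht.ne']; norm_num
  rw [e]
  have : 0 ≤ t ^ (-(1/2) : ℝ) := Real.rpow_nonneg ht.le _
  gcongr
  linarith

lemma bound_low (w x a : ℝ) (hx : 0 < x) (ha : 0 < a) (S : Set ℝ) (hS : MeasurableSet S) (hSa : S ⊆ Ioc 0 a) :
    ‖∫ t in S, (t : ℂ) ^ cw w / (x + t)‖ ≤ 2 * √a / x := by
  obtain ⟨h1, h2⟩ := int_P a ha
  have h3 : ‖∫ t in S, (t : ℂ) ^ cw w / (x + t)‖ ≤ ∫ t in S, t ^ (-(1/2) : ℝ) * (1 / x) := by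
    refine norm_integral_le_of_norm_le ((h1.mono_set hSa).mul_const _) ?_
    filter_upwards [ae_restrict_mem hS] with t ht
    exact kernel_le1 w x t hx (hSa ht).1
  refine h3.trans ?_
  have h4 : ∫ t in S, t ^ (-(1/2) : ℝ) * (1 / x) ≤ ∫ t in Ioc 0 a, t ^ (-(1/2) : ℝ) * (1 / x) := by
    refine setIntegral_mono_set (h1.mul_const _) ?_ (LE.le.eventuallyLE hSa)
    filter_upwards [ae_restrict_mem measurableSet_Ioc] with t ht
    have : 0 ≤ t ^ (-(1/2) : ℝ) := Real.rpow_nonneg ht.1.le _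
    simp only [Pi.zero_apply]
    positivity
  refine h4.trans ?_
  rw [integral_mul_const, h2]
  apply le_of_eq; ring

lemma bound_high (w x a : ℝ) (hx : 0 < x) (ha : 0 < a) (S : Set ℝ) (hS : MeasurableSet S) (hSa : S ⊆ Ioi a) :
    ‖∫ t in S, (t : ℂ) ^ cw w / (x + t)‖ ≤ 2 / √a := by
  obtain ⟨h1, h2⟩ := int_Q a ha
  have h3 : ‖∫ t in S, (t : ℂ) ^ cw w / (x + t)‖ ≤ ∫ t in S, t ^ (-(3/2) : ℝ) := by
    refine norm_integral_le_of_norm_le (h1.mono_set hSa) ?_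
    filter_upwards [ae_restrict_mem hS] with t ht
    exact kernel_le2 w x t hx (ha.trans (hSa ht))
  refine h3.trans ?_
  rw [← h2]
  refine setIntegral_mono_set h1 ?_ (LE.le.eventuallyLE hSa)
  filter_upwards [ae_restrict_mem measurableSet_Ioi] with t ht
  exact Real.rpow_nonneg (ha.trans ht).le _

lemma split_kernel (w R x : ℝ) (hR : 1 ≤ R) (hx : 0 < x) :
    (∫ t : ℝ in Ioc 1 R, (t : ℂ) ^ cw w / (x + t)) - (Real.pi / Real.cosh (Real.pi * w) : ℝ) * (x : ℂ) ^ cw w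
    = -((∫ t : ℝ in Ioc 0 1, (t : ℂ) ^ cw w / (x + t)) + ∫ t : ℝ in Ioi R, (t : ℂ) ^ cw w / (x + t)) := by
  obtain ⟨h1, h2⟩ := mellin_kernel w x hx
  have h1' : IntegrableOn (fun t : ℝ => (t : ℂ) ^ cw w / (x + t)) (Ioi 0) := h1
  have e1 : Ioi (0:ℝ) = Ioc 0 1 ∪ Ioi 1 := (Ioc_union_Ioi_eq_Ioi zero_le_one).symm
  have e2 : Ioi (1:ℝ) = Ioc 1 R ∪ Ioi R := (Ioc_union_Ioi_eq_Ioi hR).symm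
  rw [← h2]
  have e3 : ∫ t : ℝ, (t : ℂ) ^ cw w / (x + t) ∂m0 = (∫ t : ℝ in Ioc 0 1, (t : ℂ) ^ cw w / (x + t)) + ∫ t : ℝ in Ioi 1, (t : ℂ) ^ cw w / (x + t) := by
    unfold m0
    rw [← setIntegral_union Ioc_disjoint_Ioi_same measurableSet_Ioi, ← e1]
    · exact h1'.mono_set Ioc_subset_Ioi_self
    · exact h1'.mono_set (Ioi_subset_Ioi zero_le_one)
  have e4 : ∫ t : ℝ in Ioi 1, (t : ℂ) ^ cw w / (x + t) = (∫ t : ℝ in Ioc 1 R, (t : ℂ) ^ cw w / (x + t)) + ∫ t : ℝ in Ioi R, (t : ℂ) ^ cw w / (x + t) := by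
    rw [← setIntegral_union Ioc_disjoint_Ioi_same measurableSet_Ioi, ← e2]
    · exact h1'.mono_set (fun t ht => lt_trans one_pos ht.1)
    · exact h1'.mono_set (Ioi_subset_Ioi (by linarith))
  rw [e3, e4]
  ring

noncomputable def BR (R : ℝ) : ℝ → ℝ := fun t =>
  (Ioc 0 1).indicator (fun _ => 4) t + (Ioi 1).indicator (fun t => 8 * (1 / t ^ 2)) t +
  ((Ioc 0 R).indicator (fun _ => 8 / R) t + (Ioi R).indicator (fun t => 4 * R * (1 / t ^ 2)) t)

lemma BR_int (R : ℝ) (hR : 1 ≤ R) : Integrable (BR R) m0 ∧ ∫ t, BR R t ∂m0 = 24 := by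
  have hR0 : 0 < R := by linarith
  have s1 : Ioc (0:ℝ) 1 ⊆ Ioi 0 := Ioc_subset_Ioi_self
  have s2 : Ioi (1:ℝ) ⊆ Ioi 0 := Ioi_subset_Ioi zero_le_one
  have s3 : Ioc (0:ℝ) R ⊆ Ioi 0 := Ioc_subset_Ioi_self
  have s4 : Ioi R ⊆ Ioi 0 := Ioi_subset_Ioi hR0.le
  have i1 : Integrable ((Ioc (0:ℝ) 1).indicator (fun _ => (4:ℝ))) m0 := by
    rw [integrable_indicator_iff measurableSet_Ioc, IntegrableOn, m0_restrict _ measurableSet_Ioc s1]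
    exact integrable_const _
  have i2 : Integrable ((Ioi (1:ℝ)).indicator (fun t => 8 * (1 / t ^ 2))) m0 := by
    rw [integrable_indicator_iff measurableSet_Ioi, IntegrableOn, m0_restrict _ measurableSet_Ioi s2]
    exact (int_R 1 one_pos).1.const_mul 8
  have i3 : Integrable ((Ioc (0:ℝ) R).indicator (fun _ => 8 / R)) m0 := by
    rw [integrable_indicator_iff measurableSet_Ioc, IntegrableOn, m0_restrict _ measurableSet_Ioc s3]
    exact integrable_const _
  have i4 : Integrable ((Ioi R).indicator (fun t => 4 * R * (1 / t ^ 2))) m0 := by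
    rw [integrable_indicator_iff measurableSet_Ioi, IntegrableOn, m0_restrict _ measurableSet_Ioi s4]
    exact (int_R R hR0).1.const_mul (4 * R)
  refine ⟨(i1.add i2).add (i3.add i4), ?_⟩
  unfold BR
  have h12 : Integrable (fun t => (Ioc (0:ℝ) 1).indicator (fun _ => (4:ℝ)) t + (Ioi (1:ℝ)).indicator (fun t => 8 * (1 / t ^ 2)) t) m0 := i1.add i2
  have h34 : Integrable (fun t => (Ioc (0:ℝ) R).indicator (fun _ => 8 / R) t + (Ioi R).indicator (fun t => 4 * R * (1 / t ^ 2)) t) m0 := i3.add i4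
  rw [integral_add h12 h34, integral_add i1 i2, integral_add i3 i4,
    integral_indicator measurableSet_Ioc, integral_indicator measurableSet_Ioi,
    integral_indicator measurableSet_Ioc, integral_indicator measurableSet_Ioi,
    m0_restrict _ measurableSet_Ioc s1, m0_restrict _ measurableSet_Ioi s2,
    m0_restrict _ measurableSet_Ioc s3, m0_restrict _ measurableSet_Ioi s4,
    integral_const_mul, integral_const_mul, (int_R 1 one_pos).2, (int_R R hR0).2]
  simp [hR0.le]
  field_simp
  norm_num

lemma err_bound (w R x : ℝ) (hR : 1 ≤ R) (hx : 0 < x) :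
    ‖(∫ t, gR w R t / (x + t) ∂m0) - (Real.pi / Real.cosh (Real.pi * w) : ℝ) * gR w R x‖ ^ 2 ≤ BR R x := by
  rw [int_gR_kernel]
  have hR0 : 0 < R := by linarith
  by_cases h1 : x ≤ 1
  · have e : gR w R x = 0 := by
      unfold gR; rw [indicator_of_notMem]; intro h; linarith [h.1]
    rw [e, mul_zero, sub_zero]
    have h := bound_high w x 1 hx one_pos (Ioc 1 R) measurableSet_Ioc Ioc_subset_Ioi_self
    have h0 : BR R x = 4 + 8 / R := by
      unfold BR
      rw [indicator_of_mem (show x ∈ Ioc 0 1 from ⟨hx, h1⟩), indicator_of_notMem (by simpa using h1),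
        indicator_of_mem (show x ∈ Ioc 0 R from ⟨hx, h1.trans hR⟩), indicator_of_notMem (by simpa using h1.trans hR)]
      ring
    rw [h0]
    rw [Real.sqrt_one] at h
    have : 0 ≤ 8 / R := by positivity
    have h' := pow_le_pow_left₀ (norm_nonneg _) h 2
    linarith
  · push Not at h1
    by_cases h2 : x ≤ R
    · have e : gR w R x = (x : ℂ) ^ cw w := by
        unfold gR; rw [indicator_of_mem (show x ∈ Ioc 1 R from ⟨h1, h2⟩)]
      rw [e, split_kernel w R x hR hx, norm_neg]
      have a := bound_low w x 1 hx one_pos (Ioc 0 1) measurableSet_Ioc subset_rfl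
      have b := bound_high w x R hx hR0 (Ioi R) measurableSet_Ioi subset_rfl
      have h0 : BR R x = 8 * (1 / x ^ 2) + 8 / R := by
        unfold BR
        rw [indicator_of_notMem (fun h => by linarith [h.2]), indicator_of_mem (show x ∈ Ioi 1 from h1),
          indicator_of_mem (show x ∈ Ioc 0 R from ⟨hx, h2⟩), indicator_of_notMem (by simpa using h2)]
        ring
      rw [h0]
      have hab := (norm_add_le _ _).trans (add_le_add a b)
      have h' := pow_le_pow_left₀ (norm_nonneg _) hab 2
      refine h'.trans ?_
      rw [Real.sqrt_one]
      have hs : (2 / √R) ^ 2 = 4 / R := by rw [div_pow, Real.sq_sqrt hR0.le]; norm_num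
      have hs2 : (2 * 1 / x) ^ 2 = 4 * (1 / x ^ 2) := by rw [div_pow]; ring
      have := sq_nonneg (2 * 1 / x - 2 / √R)
      have e8 : 8 / R = 2 * (4 / R) := by ring
      nlinarith
    · push Not at h2
      have e : gR w R x = 0 := by
        unfold gR; rw [indicator_of_notMem]; intro h; linarith [h.2]
      rw [e, mul_zero, sub_zero]
      have h := bound_low w x R hx hR0 (Ioc 1 R) measurableSet_Ioc (fun t ht => ⟨lt_trans one_pos ht.1, ht.2⟩)
      have h0 : BR R x = 8 * (1 / x ^ 2) + 4 * R * (1 / x ^ 2) := by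
        unfold BR
        rw [indicator_of_notMem (fun h => by linarith [h.2]), indicator_of_mem (show x ∈ Ioi 1 from h1),
          indicator_of_notMem (fun h => by linarith [h.2]), indicator_of_mem (show x ∈ Ioi R from h2)]
        ring
      rw [h0]
      have h' := pow_le_pow_left₀ (norm_nonneg _) h 2
      have e2 : (2 * √R / x) ^ 2 = 4 * R * (1 / x ^ 2) := by
        rw [div_pow, mul_pow, Real.sq_sqrt hR0.le]; ring
      have : 0 ≤ 8 * (1 / x ^ 2) := by positivity
      linarith

lemma gR_norm (w R t : ℝ) : ‖gR w R t‖ = (Ioc 1 R).indicator (fun t : ℝ => t ^ (-(1/2) : ℝ)) t := by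
  unfold gR
  by_cases h : t ∈ Ioc 1 R
  · rw [indicator_of_mem h, indicator_of_mem h, norm_cpow w t (lt_trans one_pos h.1)]
  · rw [indicator_of_notMem h, indicator_of_notMem h, norm_zero]

lemma gR_norm_le (w R t : ℝ) : ‖gR w R t‖ ≤ (Ioc 1 R).indicator (fun _ => (1:ℝ)) t := by
  rw [gR_norm]
  by_cases h : t ∈ Ioc 1 R
  · rw [indicator_of_mem h, indicator_of_mem h]
    exact Real.rpow_le_one_of_one_le_of_nonpos h.1.le (by norm_num)
  · rw [indicator_of_notMem h, indicator_of_notMem h]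

lemma Ioc1_sub (R : ℝ) : Ioc 1 R ⊆ Ioi (0:ℝ) := fun _ ht => lt_trans one_pos ht.1

lemma gR_integrable (w R : ℝ) : Integrable (gR w R) m0 := by
  have : Integrable ((Ioc 1 R).indicator (fun _ => (1:ℝ))) m0 := by
    rw [integrable_indicator_iff measurableSet_Ioc, IntegrableOn, m0_restrict _ measurableSet_Ioc (Ioc1_sub R)]
    exact integrable_const _
  exact this.mono' (meas_gR w R).aestronglyMeasurable (ae_of_all _ (gR_norm_le w R))

lemma gR_sq (w R : ℝ) (hR : 1 ≤ R) : Integrable (fun t => ‖gR w R t‖ ^ 2) m0 ∧ ∫ t, ‖gR w R t‖ ^ 2 ∂m0 = Real.log R := by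
  have e : (fun t => ‖gR w R t‖ ^ 2) = (Ioc 1 R).indicator (fun t : ℝ => t⁻¹) := by
    ext t
    rw [gR_norm]
    by_cases h : t ∈ Ioc 1 R
    · rw [indicator_of_mem h, indicator_of_mem h, ← Real.rpow_natCast, ← Real.rpow_mul (lt_trans one_pos h.1).le]
      norm_num
      rw [Real.rpow_neg_one]
    · rw [indicator_of_notMem h, indicator_of_notMem h]; norm_num
  rw [e]
  constructor
  · rw [integrable_indicator_iff measurableSet_Ioc, IntegrableOn, m0_restrict _ measurableSet_Ioc (Ioc1_sub R)]
    have : IntervalIntegrable (fun t : ℝ => t⁻¹) volume 1 R := by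
      apply ContinuousOn.intervalIntegrable
      rw [uIcc_of_le hR]
      exact continuousOn_id.inv₀ (fun x hx => (show (0:ℝ) < x by linarith [hx.1]).ne')
    exact this.1
  · rw [integral_indicator measurableSet_Ioc, m0_restrict _ measurableSet_Ioc (Ioc1_sub R),
      ← intervalIntegral.integral_of_le hR, integral_inv_of_pos one_pos (by linarith), div_one]

lemma gR_memLp (w R : ℝ) (hR : 1 ≤ R) : MemLp (gR w R) 2 m0 :=
  (memLp_two_iff_integrable_sq_norm (meas_gR w R).aestronglyMeasurable).2 (gR_sq w R hR).1

lemma osc (w R t : ℝ) (hR : 1 ≤ R) (ht : 0 < t) :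
    ‖∫ ξ in (1:ℝ)..R, (ξ : ℂ) ^ cw w * Complex.exp (Complex.I * t * ξ)‖ ≤ (2 + 2 * ‖cw w‖) / t := by
  have hpos : ∀ x ∈ uIcc 1 R, 0 < x := by
    intro x hx; rw [uIcc_of_le hR] at hx; linarith [hx.1]
  have hc : cw w ≠ 0 := by
    intro h
    have := congrArg Complex.re h
    simp [cw] at this
  have hIt : Complex.I * t ≠ 0 := mul_ne_zero Complex.I_ne_zero (by exact_mod_cast ht.ne')
  have hu : ∀ x ∈ uIcc 1 R, HasDerivAt (fun ξ : ℝ => (ξ : ℂ) ^ cw w) (cw w * (x : ℂ) ^ (cw w - 1)) x := by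
    intro x hx
    have h1 : HasDerivAt (fun z : ℂ => z ^ cw w) (cw w * (x : ℂ) ^ (cw w - 1) * 1) (x : ℂ) :=
      (hasDerivAt_id _).cpow_const (Or.inl (by simpa using hpos x hx))
    rw [mul_one] at h1
    exact h1.comp_ofReal
  have hv : ∀ x ∈ uIcc 1 R, HasDerivAt (fun ξ : ℝ => Complex.exp (Complex.I * t * ξ) / (Complex.I * t))
      (Complex.exp (Complex.I * t * x)) x := by
    intro x _
    have h1 : HasDerivAt (fun z : ℂ => Complex.exp (Complex.I * t * z)) (Complex.exp (Complex.I * t * x) * (Complex.I * t)) (x : ℂ) := by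
      have := ((hasDerivAt_id (x : ℂ)).const_mul (Complex.I * t)).cexp
      simpa using this
    have h2 := (h1.div_const (Complex.I * t)).comp_ofReal
    rwa [mul_div_cancel_right₀ _ hIt] at h2
  have cu : ContinuousOn (fun x : ℝ => cw w * (x : ℂ) ^ (cw w - 1)) (uIcc 1 R) := by
    intro x hx
    have h1 : HasDerivAt (fun z : ℂ => z ^ (cw w - 1)) ((cw w - 1) * (x : ℂ) ^ (cw w - 1 - 1) * 1) (x : ℂ) :=
      (hasDerivAt_id _).cpow_const (Or.inl (by simpa using hpos x hx))
    exact (h1.comp_ofReal.continuousAt.continuousWithinAt).const_mul _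
  have cv : Continuous (fun x : ℝ => Complex.exp (Complex.I * t * x)) := by fun_prop
  have ibp := intervalIntegral.integral_mul_deriv_eq_deriv_mul hu hv cu.intervalIntegrable (cv.intervalIntegrable 1 R)
  rw [ibp]
  have nexp : ∀ x : ℝ, ‖Complex.exp (Complex.I * t * x) / (Complex.I * t)‖ = 1 / t := by
    intro x
    rw [norm_div, norm_mul, Complex.norm_I, one_mul, Complex.norm_real, Real.norm_of_nonneg ht.le,
      show Complex.I * t * x = ((t * x : ℝ) : ℂ) * Complex.I by push_cast; ring, Complex.norm_exp_ofReal_mul_I]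
  have n1 : ∀ x : ℝ, 1 ≤ x → ‖(x : ℂ) ^ cw w‖ ≤ 1 := by
    intro x hx
    rw [norm_cpow w x (by linarith)]
    exact Real.rpow_le_one_of_one_le_of_nonpos hx (by norm_num)
  have b1 : ∀ x : ℝ, 1 ≤ x → ‖(x : ℂ) ^ cw w * (Complex.exp (Complex.I * t * x) / (Complex.I * t))‖ ≤ 1 / t := by
    intro x hx
    rw [norm_mul, nexp]
    have : 0 < 1 / t := by positivity
    nlinarith [n1 x hx]
  obtain ⟨q1, q2⟩ := int_Q 1 one_pos
  have b2 : ‖∫ x in (1:ℝ)..R, cw w * (x : ℂ) ^ (cw w - 1) * (Complex.exp (Complex.I * t * x) / (Complex.I * t))‖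
      ≤ 2 * ‖cw w‖ / t := by
    rw [intervalIntegral.integral_of_le hR]
    have h3 : ‖∫ x in Ioc 1 R, cw w * (x : ℂ) ^ (cw w - 1) * (Complex.exp (Complex.I * t * x) / (Complex.I * t))‖
        ≤ ∫ x in Ioc 1 R, x ^ (-(3/2) : ℝ) * (‖cw w‖ / t) := by
      refine norm_integral_le_of_norm_le ((q1.mono_set Ioc_subset_Ioi_self).mul_const _) ?_
      filter_upwards [ae_restrict_mem measurableSet_Ioc] with x hx
      have hx0 : 0 < x := lt_trans one_pos hx.1
      rw [norm_mul, norm_mul, nexp, Complex.norm_cpow_eq_rpow_re_of_pos hx0]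
      apply le_of_eq
      have : (cw w - 1).re = -(3/2) := by simp [cw]; norm_num
      rw [this]; ring
    refine h3.trans ?_
    have h4 : ∫ x in Ioc 1 R, x ^ (-(3/2) : ℝ) * (‖cw w‖ / t) ≤ ∫ x in Ioi 1, x ^ (-(3/2) : ℝ) * (‖cw w‖ / t) := by
      refine setIntegral_mono_set (q1.mul_const _) ?_ (LE.le.eventuallyLE Ioc_subset_Ioi_self)
      filter_upwards [ae_restrict_mem measurableSet_Ioi] with x hx
      have : 0 ≤ x ^ (-(3/2) : ℝ) := Real.rpow_nonneg (lt_trans one_pos hx).le _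
      simp only [Pi.zero_apply]
      positivity
    refine h4.trans ?_
    rw [integral_mul_const, q2, Real.sqrt_one]
    apply le_of_eq; ring
  refine (norm_sub_le _ _).trans ?_
  refine (add_le_add ((norm_sub_le _ _).trans (add_le_add (b1 R hR) (b1 1 le_rfl))) b2).trans ?_
  apply le_of_eq; ring

lemma lower (T : Lp ℂ 2 m0 →L[ℂ] Lp ℂ 2 m0) (hT : FT T) (w : ℝ) (l : ℂ) (hl : l ≠ 0)
    (h : l ^ 2 = (Complex.I / (2 * Real.pi)) * (Real.pi / Real.cosh (Real.pi * w) : ℝ)) : l ∈ spectrum ℂ T := by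
  set K := 2 + 2 * ‖cw w‖ with hK
  have hK0 : 0 ≤ K := by positivity
  refine mem_spec_of_approx T l hl (5 + 2 * K) ?_
  intro N hN
  set R := Real.exp (N ^ 2) with hRdef
  have hR : 1 ≤ R := Real.one_le_exp (by positivity)
  set g : Lp ℂ 2 m0 := (gR_memLp w R hR).toLp (gR w R) with hg
  have hge : ⇑g =ᵐ[m0] gR w R := MemLp.coeFn_toLp _
  have hgi : Integrable (⇑g) m0 := (gR_integrable w R).congr hge.symm
  refine ⟨g, ?_, ?_, ?_⟩
  · have h1 : ‖g‖ ^ 2 = N ^ 2 := by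
      rw [norm_sq_Lp]
      have : ∫ t, ‖g t‖ ^ 2 ∂m0 = ∫ t, ‖gR w R t‖ ^ 2 ∂m0 := by
        apply integral_congr_ae
        filter_upwards [hge] with t ht
        rw [ht]
      rw [this, (gR_sq w R hR).2, hRdef, Real.log_exp]
    exact (pow_left_inj₀ (norm_nonneg _) (by linarith) two_ne_zero).1 h1
  · have h1 : ‖T (T g) - l ^ 2 • g‖ ^ 2 ≤ 24 := by
      rw [norm_sq_Lp, ← (BR_int R hR).2]
      refine integral_mono_of_nonneg (ae_of_all _ fun t => by positivity) (BR_int R hR).1 ?_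
      filter_upwards [tsq T hT g hgi, Lp.coeFn_sub (T (T g)) (l ^ 2 • g), Lp.coeFn_smul (l ^ 2) g, hge, ae_m0_pos] with t h1 h2 h3 h4 h5
      have e : ∫ ξ, g ξ / (t + ξ) ∂m0 = ∫ ξ, gR w R ξ / (t + ξ) ∂m0 := by
        apply integral_congr_ae
        filter_upwards [hge] with s hs
        rw [hs]
      rw [h2, Pi.sub_apply, h3, Pi.smul_apply, smul_eq_mul, h1, h4, h, e, mul_assoc, ← mul_sub, norm_mul, mul_pow]
      have hn : ‖Complex.I / (2 * (Real.pi : ℂ))‖ ≤ 1 := by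
        rw [norm_div, Complex.norm_I, norm_mul, Complex.norm_real, Real.norm_of_nonneg Real.pi_pos.le]
        rw [Complex.norm_two, div_le_one (by positivity)]
        linarith [Real.pi_gt_three]
      have hn2 : ‖Complex.I / (2 * (Real.pi : ℂ))‖ ^ 2 ≤ 1 := pow_le_one₀ (norm_nonneg _) hn
      have := err_bound w R t hR h5
      refine le_trans ?_ this
      exact mul_le_of_le_one_left (by positivity) hn2
    have h2 : ‖T (T g) - l ^ 2 • g‖ ≤ 5 := by
      apply le_of_sq_le_sq _ (by norm_num)
      linarith
    linarith
  · have hTg : ∀ᵐ t ∂m0, ‖T g t‖ ≤ K / t := by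
      filter_upwards [hT g hgi, ae_m0_pos] with t h1 h2
      have e : ∫ ξ in Ioi (0:ℝ), g ξ * Complex.exp (Complex.I * t * ξ)
          = ∫ ξ in (1:ℝ)..R, (ξ : ℂ) ^ cw w * Complex.exp (Complex.I * t * ξ) := by
        rw [intervalIntegral.integral_of_le hR]
        have e1 : ∫ ξ in Ioi (0:ℝ), g ξ * Complex.exp (Complex.I * t * ξ)
            = ∫ ξ, (Ioc 1 R).indicator (fun ξ : ℝ => (ξ : ℂ) ^ cw w * Complex.exp (Complex.I * t * ξ)) ξ ∂m0 := by
          apply integral_congr_ae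
          change _ =ᵐ[m0] _
          filter_upwards [hge] with s hs
          rw [hs]
          unfold gR
          by_cases hh : s ∈ Ioc 1 R
          · rw [indicator_of_mem hh, indicator_of_mem hh]
          · rw [indicator_of_notMem hh, indicator_of_notMem hh, zero_mul]
        rw [e1, integral_indicator measurableSet_Ioc, m0_restrict _ measurableSet_Ioc (Ioc1_sub R)]
      rw [h1, e, norm_mul]
      refine le_trans ?_ (osc w R t hR h2)
      apply mul_le_of_le_one_left (norm_nonneg _)
      rw [norm_inv, Complex.norm_real, Real.norm_of_nonneg (Real.sqrt_nonneg _)]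
      apply inv_le_one_of_one_le₀
      rw [Real.one_le_sqrt]
      linarith [Real.pi_gt_three]
    obtain ⟨q1, q2⟩ := int_Q 1 one_pos
    have s1 : Ioi (1:ℝ) ⊆ Ioi 0 := Ioi_subset_Ioi zero_le_one
    have hD : Integrable ((Ioi (1:ℝ)).indicator (fun t : ℝ => t ^ (-(3/2) : ℝ) * K)) m0 := by
      rw [integrable_indicator_iff measurableSet_Ioi, IntegrableOn, m0_restrict _ measurableSet_Ioi s1]
      exact q1.mul_const _
    have hb : ‖inner ℂ (T g) g‖ ≤ ∫ t, (Ioi (1:ℝ)).indicator (fun t : ℝ => t ^ (-(3/2) : ℝ) * K) t ∂m0 := by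
      rw [L2.inner_def]
      refine norm_integral_le_of_norm_le hD ?_
      filter_upwards [hTg, hge, ae_m0_pos] with t h1 h2 h3
      refine (norm_inner_le_norm _ _).trans ?_
      rw [h2, gR_norm]
      by_cases hh : t ∈ Ioc 1 R
      · rw [indicator_of_mem hh, indicator_of_mem (show t ∈ Ioi (1:ℝ) from hh.1)]
        have e : t ^ (-(3/2) : ℝ) = t ^ (-(1/2) : ℝ) / t := by
          rw [← Real.rpow_sub_one h3.ne']; norm_num
        rw [e]
        have : 0 ≤ t ^ (-(1/2) : ℝ) := Real.rpow_nonneg h3.le _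
        calc _ ≤ K / t * t ^ (-(1/2) : ℝ) := by gcongr
          _ = _ := by ring
      · rw [indicator_of_notMem hh, mul_zero]
        apply indicator_nonneg
        intro s hs
        have : 0 ≤ s ^ (-(3/2) : ℝ) := Real.rpow_nonneg (s1 hs).le _
        positivity
    rw [integral_indicator measurableSet_Ioi, m0_restrict _ measurableSet_Ioi s1, integral_mul_const, q2, Real.sqrt_one] at hb
    linarith

lemma e8_sq : Complex.exp (Complex.I * Real.pi / 4) ^ 2 = Complex.I := by
  rw [← Complex.exp_nat_mul]
  rw [show ((2:ℕ):ℂ) * (Complex.I * Real.pi / 4) = Real.pi / 2 * Complex.I by push_cast; ring]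
  exact Complex.exp_pi_div_two_mul_I

lemma sqrt2_sq : ((√2 : ℝ) : ℂ) ^ 2 = 2 := by
  rw [← Complex.ofReal_pow, Real.sq_sqrt (by norm_num)]; norm_num

lemma seg_iff (a z : ℂ) : z ∈ segment ℝ (-a) a ↔ ∃ s : ℝ, -1 ≤ s ∧ s ≤ 1 ∧ z = s * a := by
  constructor
  · rintro ⟨p, q, hp, hq, hpq, rfl⟩
    refine ⟨q - p, by linarith, by linarith, ?_⟩
    simp only [Complex.real_smul]
    push_cast
    ring
  · rintro ⟨s, h1, h2, rfl⟩
    refine ⟨(1 - s) / 2, (1 + s) / 2, by linarith, by linarith, by ring, ?_⟩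
    simp only [Complex.real_smul]
    push_cast
    ring

lemma cosh_surj (y : ℝ) (hy : 1 ≤ y) : ∃ x : ℝ, Real.cosh x = y := by
  have h := intermediate_value_Icc (a := (0:ℝ)) (b := y) (by linarith) Real.continuous_cosh.continuousOn
  have hm : y ∈ Icc (Real.cosh 0) (Real.cosh y) := by
    refine ⟨by simpa using hy, ?_⟩
    rw [Real.cosh_eq]
    have h1 := Real.quadratic_le_exp_of_nonneg (show (0:ℝ) ≤ y by linarith)
    have h2 := Real.add_one_le_exp (-y)
    nlinarith [sq_nonneg (y - 2), Real.exp_pos (-y)]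
  obtain ⟨x, _, hx⟩ := h hm
  exact ⟨x, hx⟩

/-- The spectrum of the truncated Fourier–Plancherel operator `T` on
`L²(ℝ⁺)` is exactly the segment `[−e^{iπ/4}/√2, e^{iπ/4}/√2]` in the complex plane. -/
theorem spectrum_truncated_fourier
    (T : Lp ℂ 2 m0 →L[ℂ] Lp ℂ 2 m0)
    (hT : ∀ x : Lp ℂ 2 m0, Integrable (⇑x) m0 →
      (⇑(T x) : ℝ → ℂ) =ᵐ[m0] fun t =>
        (Real.sqrt (2 * Real.pi) : ℂ)⁻¹ *
          ∫ ξ in Ioi (0:ℝ), x ξ * Complex.exp (Complex.I * t * ξ)) :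
    spectrum ℂ T =
      segment ℝ (-(Complex.exp (Complex.I * Real.pi / 4) / (Real.sqrt 2 : ℂ)))
        (Complex.exp (Complex.I * Real.pi / 4) / (Real.sqrt 2 : ℂ)) := by
  set a : ℂ := Complex.exp (Complex.I * Real.pi / 4) / (Real.sqrt 2 : ℂ) with ha
  have ha2 : a ^ 2 = Complex.I / 2 := by rw [ha, div_pow, e8_sq, sqrt2_sq]
  have ha0 : a ≠ 0 := by
    intro h; rw [h] at ha2; have h2 := congrArg Complex.im ha2; norm_num at h2
  have key : ∀ s : ℝ, -1 ≤ s → s ≤ 1 → s ≠ 0 → (s : ℂ) * a ∈ spectrum ℂ T := by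
    intro s h1 h2 h3
    have hs : s ^ 2 ≤ 1 := by nlinarith
    have hs0 : 0 < s ^ 2 := by positivity
    obtain ⟨x, hx⟩ := cosh_surj (1 / s ^ 2) ((one_le_div hs0).2 hs)
    refine lower T hT (x / Real.pi) _ (mul_ne_zero (by exact_mod_cast h3) ha0) ?_
    rw [mul_div_cancel₀ x Real.pi_ne_zero, hx, mul_pow, ha2]
    have hp : (Real.pi : ℂ) ≠ 0 := by exact_mod_cast Real.pi_ne_zero
    have hsc : (s : ℂ) ≠ 0 := by exact_mod_cast h3
    push_cast
    field_simp
  ext z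
  rw [seg_iff]
  constructor
  · intro hz
    obtain ⟨r, hr0, hr1, hr⟩ := spec_upper T hT z hz
    have h1 : z ^ 2 = ((√(2 * r) : ℝ) * a) ^ 2 := by
      rw [hr, mul_pow, ha2, ← Complex.ofReal_pow, Real.sq_sqrt (by linarith)]
      push_cast; ring
    have h2 : √(2 * r) ≤ 1 := by
      exact Real.sqrt_le_iff.2 ⟨zero_le_one, by linarith⟩
    have h3 := Real.sqrt_nonneg (2 * r)
    rcases sq_eq_sq_iff_eq_or_eq_neg.1 h1 with h | h
    · exact ⟨_, by linarith, h2, h⟩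
    · refine ⟨-√(2 * r), by linarith, by linarith, ?_⟩
      rw [h]; push_cast; ring
  · rintro ⟨s, h1, h2, rfl⟩
    by_cases hs : s = 0
    · subst hs
      have hcl : IsClosed (spectrum ℂ T) := spectrum.isClosed T
      have ht : Tendsto (fun n : ℕ => ((1 / ((n : ℝ) + 1) : ℝ) : ℂ) * a) atTop (𝓝 (((0:ℝ) : ℂ) * a)) := by
        apply Tendsto.mul_const
        exact (Complex.continuous_ofReal.tendsto 0).comp tendsto_one_div_add_atTop_nhds_zero_nat
      refine hcl.mem_of_tendsto ht (Eventually.of_forall fun n => key _ ?_ ?_ ?_)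
      · have : 0 < 1 / ((n : ℝ) + 1) := by positivity
        linarith
      · rw [div_le_one (by positivity)]
        linarith [Nat.cast_nonneg (α := ℝ) n]
      · positivity
    · exact key s h1 h2 hs
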